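/- arXiv:1808.10021 — 9 statements merged into one kernel-verified Lean document; each statement's English description precedes it below -/
import Mathlib

section
/- Let X and Y be complex Hilbert spaces, let A, Q̄ ∈ L(X) be bounded operators with Q̄ self-adjoint, let C ∈ L(X,Y) and let Q ∈ L(Y) be self-adjoint. Let δ > 0 be such that δI − A is invertible in L(X), and define the Cayley–Tustin operators A_d := −I + 2δ(δI−A)^{−1} and C_d := √(2δ) C(δI−A)^{−1}. Then Q̄ satisfies the continuous-time Lyapunov equation A*Q̄ + Q̄A = −C*QC if and only if Q̄ satisfies the discrete-time Lyapunov equation A_d*Q̄A_d − Q̄ = −C_d*QC_d. -/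
open ContinuousLinearMap

/-- The congruence by the resolvent that turns the continuous-time Lyapunov operator into the
discrete-time one. -/
theorem cayley_lyapunov_identity {X : Type*}
    [NormedAddCommGroup X] [InnerProductSpace ℂ X] [CompleteSpace X]
    (A P R : X →L[ℂ] X) (δ : ℝ) (hR : ((δ : ℂ) • (1 : X →L[ℂ] X) - A) * R = 1) :
    adjoint (-1 + (2 * (δ : ℂ)) • R) * P * (-1 + (2 * (δ : ℂ)) • R) - P
      = (2 * (δ : ℂ)) • (adjoint R * (adjoint A * P + P * A) * R) := by
  simp only [← star_eq_adjoint]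
  have hAR : A * R = (δ : ℂ) • R - 1 := by
    rw [sub_mul, smul_mul_assoc, one_mul] at hR
    rw [← hR, sub_sub_cancel]
  have hRA : star R * star A = (δ : ℂ) • star R - 1 := by
    rw [← star_mul, hAR]
    simp
  have h : star R * (star A * P + P * A) * R
      = (star R * star A) * P * R + star R * P * (A * R) := by noncomm_ring
  rw [h, hAR, hRA]
  simp only [star_add, star_neg, star_one, star_smul, star_mul', Complex.star_def,
    Complex.conj_ofReal, map_ofNat, mul_add, add_mul, mul_sub, sub_mul, neg_mul, mul_neg,
    one_mul, mul_one, smul_mul_assoc, mul_smul_comm]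
  module

/-- Congruence by operators with one-sided inverses is injective. -/
theorem mul_mul_cancel_of_inverses {M : Type*} [Monoid M] {a a' b b' x y : M}
    (ha : a' * a = 1) (hb : b * b' = 1) : a * x * b = a * y * b ↔ x = y := by
  refine ⟨fun h => ?_, fun h => by rw [h]⟩
  have key : ∀ z : M, a' * (a * z * b) * b' = z := fun z => by
    rw [mul_assoc a z b, ← mul_assoc a' a, ha, one_mul, mul_assoc, hb, mul_one]
  rw [← key x, h, key]

/-- The Cayley–Tustin transform maps solutions of the continuous-time
Lyapunov equation to solutions of the discrete-time Lyapunov equation and vice versa. -/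
theorem cayley_tustin_lyapunov
    {X Y : Type*}
    [NormedAddCommGroup X] [InnerProductSpace ℂ X] [CompleteSpace X]
    [NormedAddCommGroup Y] [InnerProductSpace ℂ Y] [CompleteSpace Y]
    (A Qbar : X →L[ℂ] X) (C : X →L[ℂ] Y) (Q : Y →L[ℂ] Y)
    (hQbar : IsSelfAdjoint Qbar) (hQ : IsSelfAdjoint Q)
    (δ : ℝ) (hδ : 0 < δ)
    -- `Rres` is the resolvent operator, i.e. the inverse of `δI - A` in `L(X)`
    (Rres : X →L[ℂ] X)
    (hR1 : ((δ : ℂ) • (1 : X →L[ℂ] X) - A) * Rres = 1)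
    (hR2 : Rres * ((δ : ℂ) • (1 : X →L[ℂ] X) - A) = 1) :
    -- continuous-time Lyapunov equation A*Q̄ + Q̄A = −C*QC
    (adjoint A * Qbar + Qbar * A = -(adjoint C ∘L (Q ∘L C))) ↔
    -- discrete-time Lyapunov equation A_d*Q̄A_d − Q̄ = −C_d*QC_d
    (adjoint (-1 + (2 * (δ : ℂ)) • Rres) * Qbar * (-1 + (2 * (δ : ℂ)) • Rres) - Qbar
      = -(adjoint (((Real.sqrt (2 * δ) : ℝ) : ℂ) • (C ∘L Rres)) ∘L
          (Q ∘L (((Real.sqrt (2 * δ) : ℝ) : ℂ) • (C ∘L Rres))))) := by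
  have hδ' : (2 * (δ : ℂ)) ≠ 0 := by simpa using hδ.ne'
  have hsqrt : ((Real.sqrt (2 * δ) : ℝ) : ℂ) * ((Real.sqrt (2 * δ) : ℝ) : ℂ) = 2 * (δ : ℂ) := by
    rw [← Complex.ofReal_mul, Real.mul_self_sqrt (by positivity)]
    push_cast
    rfl
  have hC : adjoint (((Real.sqrt (2 * δ) : ℝ) : ℂ) • (C ∘L Rres)) ∘L
      (Q ∘L (((Real.sqrt (2 * δ) : ℝ) : ℂ) • (C ∘L Rres)))
      = (2 * (δ : ℂ)) • (adjoint Rres * (adjoint C ∘L (Q ∘L C)) * Rres) := by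
    rw [map_smulₛₗ, adjoint_comp, Complex.conj_ofReal, ← hsqrt]
    ext x
    simp [mul_smul]
  have hS : star ((δ : ℂ) • (1 : X →L[ℂ] X) - A) * star Rres = 1 := by
    rw [← star_mul, hR2, star_one]
  rw [cayley_lyapunov_identity A Qbar Rres δ hR1, hC, ← smul_neg,
    (smul_right_injective _ hδ').eq_iff,
    ← neg_mul, ← mul_neg, ← star_eq_adjoint Rres, mul_mul_cancel_of_inverses hS hR2]
end

section
/- Let X, U and Y be complex Hilbert spaces, let A ∈ L(X), B ∈ L(U,X), C ∈ L(X,Y), D ∈ L(U,Y), and let K_y ∈ L(Y,U) be an output feedback operator such that I − DK_y is invertible in L(Y). Set à := A + BK_y(I−DK_y)^{−1}C. Let δ > 0 be such that both δI − A and δI − à are invertible in L(X), define the Cayley–Tustin operators A_d = −I + 2δ(δI−A)^{−1}, B_d = √(2δ)(δI−A)^{−1}B, C_d = √(2δ)C(δI−A)^{−1}, D_d = C(δI−A)^{−1}B + D, and assume that I − D_dK_y is invertible in L(Y). Then −I + 2δ(δI−Ã)^{−1} = A_d + B_dK_y(I − D_dK_y)^{−1}C_d; that is, output feedback commutes with the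 Cayley–Tustin discretization. -/
open ContinuousLinearMap

/-- Output feedback commutes with the Cayley–Tustin discretization:
the Cayley–Tustin transform of `A + BK_y(I−DK_y)⁻¹C` equals
`A_d + B_dK_y(I − D_dK_y)⁻¹C_d`. -/
theorem cayley_tustin_output_feedback
    {X U Y : Type*}
    [NormedAddCommGroup X] [InnerProductSpace ℂ X] [CompleteSpace X]
    [NormedAddCommGroup U] [InnerProductSpace ℂ U] [CompleteSpace U]
    [NormedAddCommGroup Y] [InnerProductSpace ℂ Y] [CompleteSpace Y]
    (A : X →L[ℂ] X) (B : U →L[ℂ] X) (C : X →L[ℂ] Y) (D : U →L[ℂ] Y)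
    (Ky : Y →L[ℂ] U)
    -- `W` is the inverse of `I − DK_y` in `L(Y)`
    (W : Y →L[ℂ] Y)
    (hW1 : (1 - D ∘L Ky) * W = 1) (hW2 : W * (1 - D ∘L Ky) = 1)
    (δ : ℝ) (hδ : 0 < δ)
    -- `Rres` is the inverse of `δI − A` in `L(X)`
    (Rres : X →L[ℂ] X)
    (hR1 : ((δ : ℂ) • (1 : X →L[ℂ] X) - A) * Rres = 1)
    (hR2 : Rres * ((δ : ℂ) • (1 : X →L[ℂ] X) - A) = 1)
    -- `RresT` is the inverse of `δI − Ã` in `L(X)`, where `Ã := A + BK_y(I−DK_y)⁻¹C`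
    (RresT : X →L[ℂ] X)
    (hRT1 : ((δ : ℂ) • (1 : X →L[ℂ] X) - (A + B ∘L (Ky ∘L (W ∘L C)))) * RresT = 1)
    (hRT2 : RresT * ((δ : ℂ) • (1 : X →L[ℂ] X) - (A + B ∘L (Ky ∘L (W ∘L C)))) = 1)
    -- `Wd` is the inverse of `I − D_dK_y` in `L(Y)`, where `D_d := C(δI−A)⁻¹B + D`
    (Wd : Y →L[ℂ] Y)
    (hWd1 : (1 - (C ∘L Rres ∘L B + D) ∘L Ky) * Wd = 1)
    (hWd2 : Wd * (1 - (C ∘L Rres ∘L B + D) ∘L Ky) = 1) :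
    -- conclusion: −I + 2δ(δI−Ã)⁻¹ = A_d + B_dK_y(I − D_dK_y)⁻¹C_d
    -1 + (2 * (δ : ℂ)) • RresT
      = (-1 + (2 * (δ : ℂ)) • Rres)
        + (((Real.sqrt (2 * δ) : ℝ) : ℂ) • (Rres ∘L B)) ∘L
            (Ky ∘L (Wd ∘L (((Real.sqrt (2 * δ) : ℝ) : ℂ) • (C ∘L Rres)))) := by
  have key : ∀ x, RresT x = Rres x + Rres (B (Ky (Wd (C (Rres x))))) := by
    intro x
    set w := Wd (C (Rres x)) with hw
    set s := Rres x + Rres (B (Ky w)) with hs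
    have hloop : w - (C (Rres (B (Ky w))) + D (Ky w)) = C (Rres x) := by
      simpa [hw] using DFunLike.congr_fun hWd1 (C (Rres x))
    have hWw : W (w - D (Ky w)) = w := by
      simpa using DFunLike.congr_fun hW2 w
    have hCs : C s = w - D (Ky w) := by
      rw [hs, map_add, ← hloop]
      abel
    have hres : ∀ z, (δ : ℂ) • Rres z - A (Rres z) = z := fun z => by
      simpa using DFunLike.congr_fun hR1 z
    have hAs : (δ : ℂ) • s - A s = x + B (Ky w) := by
      rw [hs, map_add, smul_add, add_sub_add_comm, hres, hres]
    have hNs : ((δ : ℂ) • (1 : X →L[ℂ] X) - (A + B ∘L (Ky ∘L (W ∘L C)))) s = x := by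
      change (δ : ℂ) • s - (A s + B (Ky (W (C s)))) = x
      rw [hCs, hWw, ← sub_sub, hAs, add_sub_cancel_right]
    have hinv := DFunLike.congr_fun hRT2 s
    rwa [mul_apply_eq_comp, hNs] at hinv
  have hsqrt : ((Real.sqrt (2 * δ) : ℝ) : ℂ) * ((Real.sqrt (2 * δ) : ℝ) : ℂ) = 2 * (δ : ℂ) := by
    rw [← Complex.ofReal_mul, Real.mul_self_sqrt (by positivity)]
    push_cast
    rfl
  ext x
  simp only [add_apply, FunLike.coe_smul, Pi.smul_apply, ContinuousLinearMap.coe_comp, Function.comp_apply, map_smul,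
    smul_smul, hsqrt, key, smul_add, add_assoc]
end

section
/- Let ρ, T, κ be real with ρ, T > 0 and 0 < κ < √(ρT), and set λ₀ := (1/2)√(T/ρ)·log((√(ρT)−κ)/(√(ρT)+κ)) (a negative real number). Then the set of all λ ∈ ℂ satisfying the characteristic equation √(T/ρ)·sinh(√(ρ/T)·λ) + (κ/ρ)·cosh(√(ρ/T)·λ) = 0 is exactly { λ₀ + √(T/ρ)·kπi : k ∈ ℤ }. -/
/-- `λ₀ = (1/2)√(T/ρ)·log((√(ρT)−κ)/(√(ρT)+κ))` -/
noncomputable def waveLambdaZero (ρ T κ : ℝ) : ℝ :=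
  (1 / 2) * Real.sqrt (T / ρ) *
    Real.log ((Real.sqrt (ρ * T) - κ) / (Real.sqrt (ρ * T) + κ))

/-- The solutions of `a sinh z + b cosh z = 0` for real `|b| < a`. -/
theorem mul_sinh_add_mul_cosh_eq_zero_iff {a b : ℝ} (hab : 0 < a + b) (hba : 0 < a - b) (z : ℂ) :
    (a : ℂ) * Complex.sinh z + (b : ℂ) * Complex.cosh z = 0 ↔
      ∃ k : ℤ, z = ((1 / 2 * Real.log ((a - b) / (a + b)) : ℝ) : ℂ) + k * Real.pi * Complex.I := by
  have hne : (a : ℂ) + b ≠ 0 := by exact_mod_cast hab.ne'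
  have hexp : Complex.exp (Real.log ((a - b) / (a + b)) : ℝ) = ((a : ℂ) - b) / (a + b) := by
    rw [← Complex.ofReal_exp, Real.exp_log (div_pos hba hab)]
    push_cast
    rfl
  have hmul : (2 * Complex.exp z) * ((a : ℂ) * Complex.sinh z + (b : ℂ) * Complex.cosh z) =
      (a + b) * Complex.exp (2 * z) - (a - b) := by
    have hinv : Complex.exp z * Complex.exp (-z) = 1 := by
      rw [← Complex.exp_add, add_neg_cancel, Complex.exp_zero]
    rw [Complex.sinh, Complex.cosh, two_mul z, Complex.exp_add]
    linear_combination ((b : ℂ) - a) * hinv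
  have hiff : (a : ℂ) * Complex.sinh z + (b : ℂ) * Complex.cosh z = 0 ↔
      Complex.exp (2 * z) = Complex.exp (Real.log ((a - b) / (a + b)) : ℝ) := by
    rw [hexp, eq_div_iff hne, mul_comm (Complex.exp _), ← sub_eq_zero (b := (a : ℂ) - b), ← hmul,
      mul_eq_zero, or_iff_right (mul_ne_zero two_ne_zero (Complex.exp_ne_zero z))]
  rw [hiff, Complex.exp_eq_exp_iff_exists_int]
  refine exists_congr fun k => ?_
  rw [Complex.ofReal_mul]
  push_cast
  constructor <;> intro h
  · linear_combination (1 / 2 : ℂ) * h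
  · linear_combination (2 : ℂ) * h

/-- for the damped wave equation with `0 < κ < √(ρT)`, the set of solutions
of the characteristic equation `√(T/ρ)·sinh(√(ρ/T)λ) + (κ/ρ)·cosh(√(ρ/T)λ) = 0` is
exactly `{ λ₀ + √(T/ρ)·kπi : k ∈ ℤ }`. -/
theorem wave_characteristic_equation_solutions
    (ρ T κ : ℝ) (hρ : 0 < ρ) (hT : 0 < T) (hκ : 0 < κ)
    (hκ' : κ < Real.sqrt (ρ * T)) :
    {lam : ℂ |
        (Real.sqrt (T / ρ) : ℂ) * Complex.sinh ((Real.sqrt (ρ / T) : ℂ) * lam)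
          + ((κ / ρ : ℝ) : ℂ) * Complex.cosh ((Real.sqrt (ρ / T) : ℂ) * lam) = 0}
      = {lam : ℂ | ∃ k : ℤ,
          lam = ((waveLambdaZero ρ T κ : ℝ) : ℂ)
            + (Real.sqrt (T / ρ) : ℂ) * (k : ℂ) * (Real.pi : ℂ) * Complex.I} := by
  have hs : 0 < Real.sqrt (T / ρ) := Real.sqrt_pos.2 (div_pos hT hρ)
  have hinv : Real.sqrt (ρ / T) = (Real.sqrt (T / ρ))⁻¹ := by rw [← Real.sqrt_inv, inv_div]
  have hmul : Real.sqrt (ρ * T) = ρ * Real.sqrt (T / ρ) := by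
    rw [show ρ * T = ρ ^ 2 * (T / ρ) by field_simp, Real.sqrt_mul (sq_nonneg ρ),
      Real.sqrt_sq hρ.le]
  unfold waveLambdaZero
  rw [hmul] at hκ' ⊢
  rw [hinv]
  generalize Real.sqrt (T / ρ) = s at hs hκ'
  have hlt : κ / ρ < s := (div_lt_iff₀' hρ).2 hκ'
  have hpos : 0 < κ / ρ := div_pos hκ hρ
  have hratio : (ρ * s - κ) / (ρ * s + κ) = (s - κ / ρ) / (s + κ / ρ) := by
    field_simp
  have hsC : (s : ℂ) ≠ 0 := by exact_mod_cast hs.ne'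
  ext lam
  rw [Set.mem_ofPred_eq, Set.mem_ofPred_eq,
    mul_sinh_add_mul_cosh_eq_zero_iff (add_pos hs hpos) (sub_pos.2 hlt), hratio]
  refine exists_congr fun k => ?_
  rw [Complex.ofReal_inv, inv_mul_eq_iff_eq_mul₀ hsC]
  generalize Real.log ((s - κ / ρ) / (s + κ / ρ)) = l
  push_cast
  constructor <;> intro h <;> linear_combination h
end

section
/- Let ρ, T, κ be real with ρ, T, κ > 0 and κ ≠ √(ρT). Then every λ ∈ ℂ satisfying the characteristic equation √(T/ρ)·sinh(√(ρ/T)·λ) + (κ/ρ)·cosh(√(ρ/T)·λ) = 0 has real part Re λ = (1/2)√(T/ρ)·log(|√(ρT)−κ|/(√(ρT)+κ)), which is strictly negative; i.e., all eigenvalues of the damped wave generator lie on a common vertical line in the open left half-plane. -/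
/-- The real part of any zero of `z ↦ a sinh z + b cosh z`, for positive reals `a ≠ b`. -/
theorem two_mul_re_eq_log_of_sinh_add_cosh_eq_zero {a b : ℝ} (ha : 0 < a) (hb : 0 < b) (hab : b ≠ a)
    {z : ℂ} (hz : (a : ℂ) * Complex.sinh z + (b : ℂ) * Complex.cosh z = 0) :
    2 * z.re = Real.log (|a - b| / (a + b)) := by
  have hexp : ((a + b : ℝ) : ℂ) * Complex.exp z = ((a - b : ℝ) : ℂ) * Complex.exp (-z) := by
    rw [Complex.sinh, Complex.cosh] at hz
    push_cast
    linear_combination 2 * hz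
  have hnorm := congrArg norm hexp
  rw [norm_mul, norm_mul, Complex.norm_exp, Complex.norm_exp, Complex.norm_real,
    Complex.norm_real, Real.norm_eq_abs, Real.norm_eq_abs, abs_of_pos (add_pos ha hb),
    Complex.neg_re] at hnorm
  have hne : |a - b| ≠ 0 := abs_ne_zero.mpr (sub_ne_zero.mpr hab.symm)
  have hlog := congrArg Real.log hnorm
  rw [Real.log_mul (add_pos ha hb).ne' (Real.exp_ne_zero _), Real.log_mul hne (Real.exp_ne_zero _),
    Real.log_exp, Real.log_exp] at hlog
  rw [Real.log_div hne (add_pos ha hb).ne']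
  linarith

theorem log_abs_sub_div_add_neg {a b : ℝ} (ha : 0 < a) (hb : 0 < b) (hab : b ≠ a) :
    Real.log (|a - b| / (a + b)) < 0 := by
  have hpos : 0 < |a - b| := abs_pos.mpr (sub_ne_zero.mpr hab.symm)
  refine Real.log_neg (div_pos hpos (add_pos ha hb)) ?_
  rw [div_lt_one (add_pos ha hb), abs_lt]
  constructor <;> linarith

/-- for the damped wave equation with `ρ, T, κ > 0`, `κ ≠ √(ρT)`, every
solution `λ` of the characteristic equation
`√(T/ρ)·sinh(√(ρ/T)λ) + (κ/ρ)·cosh(√(ρ/T)λ) = 0` has real part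
`(1/2)√(T/ρ)·log(|√(ρT)−κ|/(√(ρT)+κ))`, which is strictly negative. -/
theorem wave_eigenvalues_common_negative_real_part
    (ρ T κ : ℝ) (hρ : 0 < ρ) (hT : 0 < T) (hκ : 0 < κ)
    (hκ' : κ ≠ Real.sqrt (ρ * T))
    (lam : ℂ)
    (hlam : (Real.sqrt (T / ρ) : ℂ) * Complex.sinh ((Real.sqrt (ρ / T) : ℂ) * lam)
        + ((κ / ρ : ℝ) : ℂ) * Complex.cosh ((Real.sqrt (ρ / T) : ℂ) * lam) = 0) :
    lam.re = (1 / 2) * Real.sqrt (T / ρ) *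
        Real.log (|Real.sqrt (ρ * T) - κ| / (Real.sqrt (ρ * T) + κ))
      ∧ lam.re < 0 := by
  have hs : 0 < Real.sqrt (T / ρ) := Real.sqrt_pos.mpr (div_pos hT hρ)
  have hm : 0 < Real.sqrt (ρ * T) := Real.sqrt_pos.mpr (mul_pos hρ hT)
  have hsm : ρ * Real.sqrt (T / ρ) = Real.sqrt (ρ * T) := by
    rw [show ρ * T = ρ ^ 2 * (T / ρ) by field_simp, Real.sqrt_mul (sq_nonneg ρ),
      Real.sqrt_sq hρ.le]
  have hsc : Real.sqrt (T / ρ) * Real.sqrt (ρ / T) = 1 := by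
    rw [← Real.sqrt_mul (div_pos hT hρ).le, show T / ρ * (ρ / T) = 1 by field_simp, Real.sqrt_one]
  have hz : ((Real.sqrt (ρ * T) : ℝ) : ℂ) * Complex.sinh ((Real.sqrt (ρ / T) : ℂ) * lam)
      + (κ : ℂ) * Complex.cosh ((Real.sqrt (ρ / T) : ℂ) * lam) = 0 := by
    have hκρ : (ρ : ℂ) * ((κ / ρ : ℝ) : ℂ) = κ := by
      rw [← Complex.ofReal_mul, mul_div_cancel₀ κ hρ.ne']
    rw [← hsm, Complex.ofReal_mul, ← hκρ]
    linear_combination (ρ : ℂ) * hlam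
  have hre := two_mul_re_eq_log_of_sinh_add_cosh_eq_zero hm hκ hκ' hz
  rw [Complex.re_ofReal_mul] at hre
  have hmain : lam.re = (1 / 2) * Real.sqrt (T / ρ) *
      Real.log (|Real.sqrt (ρ * T) - κ| / (Real.sqrt (ρ * T) + κ)) := by
    rw [← hre]
    linear_combination -lam.re * hsc
  refine ⟨hmain, ?_⟩
  rw [hmain]
  exact mul_neg_of_pos_of_neg (by positivity) (log_abs_sub_div_add_neg hm hκ hκ')
end

section
/- Let ρ, T, κ be real with ρ, T > 0 and 0 < κ < √(ρT), let λ₀ := (1/2)√(T/ρ)·log((√(ρT)−κ)/(√(ρT)+κ)), and for k ∈ ℤ let λ_k := λ₀ + √(T/ρ)·kπi. Define φ_k : [0,1] → ℂ² by φ_k(ζ) = (cosh(√(ρ/T)·λ_k·ζ), (ρT)^{−1/2}·sinh(√(ρ/T)·λ_k·ζ)). Then for every k ∈ ℤ: (i) d/dζ (T · φ_{k,2}(ζ)) = λ_k · φ_{k,1}(ζ) and d/dζ (ρ^{−1} · φ_{k,1}(ζ)) = λ_k · φ_{k,2}(ζ) for all ζ ∈ [0,1], and (ii) the boundary conditions T·φ_{k,2}(0)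 = 0 and T·φ_{k,2}(1) + (κ/ρ)·φ_{k,1}(1) = 0 hold; i.e., φ_k is an eigenfunction of the wave generator with eigenvalue λ_k. -/
/-- `λ_k = λ₀ + √(T/ρ)·kπi` -/
noncomputable def waveLambda (ρ T κ : ℝ) (k : ℤ) : ℂ :=
  ((waveLambdaZero ρ T κ : ℝ) : ℂ)
    + (Real.sqrt (T / ρ) : ℂ) * (k : ℂ) * (Real.pi : ℂ) * Complex.I

/-- first component of the eigenfunction: `φ_{k,1}(ζ) = cosh(√(ρ/T)·λ_k·ζ)` -/
noncomputable def wavePhi1 (ρ T κ : ℝ) (k : ℤ) (ζ : ℝ) : ℂ :=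
  Complex.cosh ((Real.sqrt (ρ / T) : ℂ) * waveLambda ρ T κ k * (ζ : ℂ))

/-- second component of the eigenfunction:
`φ_{k,2}(ζ) = (ρT)^{−1/2}·sinh(√(ρ/T)·λ_k·ζ)` -/
noncomputable def wavePhi2 (ρ T κ : ℝ) (k : ℤ) (ζ : ℝ) : ℂ :=
  ((Real.sqrt (ρ * T) : ℂ))⁻¹ *
    Complex.sinh ((Real.sqrt (ρ / T) : ℂ) * waveLambda ρ T κ k * (ζ : ℂ))

/-- A complex form of `tanh w = -κ / s`, read off from `exp (2 * w) = (s - κ) / (s + κ)`. -/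
theorem Complex.mul_sinh_add_mul_cosh_eq_zero {s κ w : ℂ} (hs : s + κ ≠ 0)
    (h : Complex.exp (2 * w) = (s - κ) / (s + κ)) :
    s * Complex.sinh w + κ * Complex.cosh w = 0 := by
  have h1 : Complex.exp w * Complex.exp (-w) = 1 := by
    rw [← Complex.exp_add, add_neg_cancel, Complex.exp_zero]
  rw [two_mul, Complex.exp_add, eq_div_iff hs] at h
  rw [Complex.sinh, Complex.cosh]
  linear_combination Complex.exp (-w) / 2 * h - (s + κ) * Complex.exp w / 2 * h1

theorem exp_two_mul_sqrt_mul_waveLambda {ρ T κ : ℝ} (hρ : 0 < ρ) (hT : 0 < T) (hκ : 0 < κ)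
    (hκ' : κ < Real.sqrt (ρ * T)) (k : ℤ) :
    Complex.exp (2 * ((Real.sqrt (ρ / T) : ℂ) * waveLambda ρ T κ k)) =
      ((Real.sqrt (ρ * T) : ℂ) - κ) / ((Real.sqrt (ρ * T) : ℂ) + κ) := by
  have hab : (Real.sqrt (ρ / T) : ℂ) * (Real.sqrt (T / ρ) : ℂ) = 1 := by
    rw [← Complex.ofReal_mul, ← Real.sqrt_mul (by positivity), div_mul_div_cancel₀ hT.ne',
      div_self hρ.ne', Real.sqrt_one, Complex.ofReal_one]
  have hr : 0 < (Real.sqrt (ρ * T) - κ) / (Real.sqrt (ρ * T) + κ) :=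
    div_pos (by linarith) (by linarith)
  have hw : 2 * ((Real.sqrt (ρ / T) : ℂ) * waveLambda ρ T κ k) =
      (Real.log ((Real.sqrt (ρ * T) - κ) / (Real.sqrt (ρ * T) + κ)) : ℂ)
        + k * (2 * Real.pi * Complex.I) := by
    rw [waveLambda, waveLambdaZero, Complex.ofReal_mul, Complex.ofReal_mul]
    push_cast
    linear_combination ((Real.log ((Real.sqrt (ρ * T) - κ) / (Real.sqrt (ρ * T) + κ)) : ℂ)
        + k * (2 * Real.pi * Complex.I)) * hab
  rw [hw, Complex.exp_add, Complex.exp_int_mul_two_pi_mul_I, mul_one, ← Complex.ofReal_exp,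
    Real.exp_log hr]
  push_cast
  rfl

/-- each `φ_k` is an eigenfunction of the damped wave generator with
eigenvalue `λ_k`: it satisfies `(Tφ_{k,2})′ = λ_k φ_{k,1}`, `(ρ⁻¹φ_{k,1})′ = λ_k φ_{k,2}`
on `[0,1]` and the boundary conditions `Tφ_{k,2}(0) = 0`,
`Tφ_{k,2}(1) + (κ/ρ)φ_{k,1}(1) = 0`. -/
theorem wave_eigenfunctions
    (ρ T κ : ℝ) (hρ : 0 < ρ) (hT : 0 < T) (hκ : 0 < κ)
    (hκ' : κ < Real.sqrt (ρ * T)) (k : ℤ) :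
    (∀ ζ ∈ Set.Icc (0 : ℝ) 1,
        HasDerivAt (fun z : ℝ => (T : ℂ) * wavePhi2 ρ T κ k z)
          (waveLambda ρ T κ k * wavePhi1 ρ T κ k ζ) ζ
      ∧ HasDerivAt (fun z : ℝ => ((ρ : ℂ))⁻¹ * wavePhi1 ρ T κ k z)
          (waveLambda ρ T κ k * wavePhi2 ρ T κ k ζ) ζ)
    ∧ (T : ℂ) * wavePhi2 ρ T κ k 0 = 0
    ∧ (T : ℂ) * wavePhi2 ρ T κ k 1 + ((κ / ρ : ℝ) : ℂ) * wavePhi1 ρ T κ k 1 = 0 := by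
  have hs : (Real.sqrt (ρ * T) : ℂ) ≠ 0 := by
    exact_mod_cast (Real.sqrt_pos.2 (mul_pos hρ hT)).ne'
  have hρ0 : (ρ : ℂ) ≠ 0 := by exact_mod_cast hρ.ne'
  have has : (Real.sqrt (ρ / T) : ℂ) * (Real.sqrt (ρ * T) : ℂ) = ρ := by
    rw [← Complex.ofReal_mul, ← Real.sqrt_mul (by positivity),
      show ρ / T * (ρ * T) = ρ ^ 2 by field_simp, Real.sqrt_sq hρ.le]
  have hss : (Real.sqrt (ρ * T) : ℂ) * (Real.sqrt (ρ * T) : ℂ) = ρ * T := by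
    rw [← Complex.ofReal_mul, Real.mul_self_sqrt (by positivity), Complex.ofReal_mul]
  have haT : (T : ℂ) * (Real.sqrt (ρ / T) : ℂ) = Real.sqrt (ρ * T) := by
    apply mul_right_cancel₀ hs
    linear_combination (T : ℂ) * has - hss
  have hlin (z : ℂ) : HasDerivAt (fun z : ℂ => (Real.sqrt (ρ / T) : ℂ) * waveLambda ρ T κ k * z)
      ((Real.sqrt (ρ / T) : ℂ) * waveLambda ρ T κ k) z := by
    simpa using (hasDerivAt_id z).const_mul ((Real.sqrt (ρ / T) : ℂ) * waveLambda ρ T κ k)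
  refine ⟨fun ζ _ => ⟨?_, ?_⟩, by simp [wavePhi2], ?_⟩
  · refine (((hlin ζ).csinh.const_mul _).const_mul (T : ℂ)).comp_ofReal.congr_deriv ?_
    rw [wavePhi1]
    field_simp
    linear_combination waveLambda ρ T κ k *
      Complex.cosh ((Real.sqrt (ρ / T) : ℂ) * waveLambda ρ T κ k * (ζ : ℂ)) * haT
  · refine ((hlin ζ).ccosh.const_mul (ρ : ℂ)⁻¹).comp_ofReal.congr_deriv ?_
    rw [wavePhi2]
    field_simp
    linear_combination waveLambda ρ T κ k *
      Complex.sinh ((Real.sqrt (ρ / T) : ℂ) * waveLambda ρ T κ k * (ζ : ℂ)) * has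
  · have hsκ : (Real.sqrt (ρ * T) : ℂ) + κ ≠ 0 := by
      exact_mod_cast (add_pos (hκ.trans hκ') hκ).ne'
    have h := Complex.mul_sinh_add_mul_cosh_eq_zero hsκ
      (exp_two_mul_sqrt_mul_waveLambda hρ hT hκ hκ' k)
    have hTs : (T : ℂ) * (Real.sqrt (ρ * T) : ℂ)⁻¹ = (ρ : ℂ)⁻¹ * Real.sqrt (ρ * T) := by
      field_simp
      linear_combination -hss
    rw [wavePhi1, wavePhi2, Complex.ofReal_one, mul_one, ← mul_assoc, hTs, Complex.ofReal_div]
    linear_combination (ρ : ℂ)⁻¹ * h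
end

section
/- Let ρ, T, κ be real with ρ, T > 0 and 0 < κ < √(ρT), let λ₀ := (1/2)√(T/ρ)·log((√(ρT)−κ)/(√(ρT)+κ)), and for k ∈ ℤ let λ_k := λ₀ + √(T/ρ)·kπi and φ_k(ζ) := (cosh(√(ρ/T)·λ_k·ζ), (ρT)^{−1/2}·sinh(√(ρ/T)·λ_k·ζ)). Define the 2×2 matrix M(ζ) with rows (cosh(√(ρ/T)λ₀ζ), −√(ρT)·sinh(√(ρ/T)λ₀ζ)) and (i·sinh(√(ρ/T)λ₀ζ), −i√(ρT)·cosh(√(ρ/T)λ₀ζ)). Then for every k ∈ ℤ and every ζ ∈ [0,1], M(ζ)·φ_k(ζ) = (cos(kπζ), sin(kπζ)). -/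
open scoped Matrix

/-- the eigenvector `φ_k(ζ) = (cosh(√(ρ/T)λ_kζ), (ρT)^{−1/2}sinh(√(ρ/T)λ_kζ))` -/
noncomputable def wavePhi (ρ T κ : ℝ) (k : ℤ) (ζ : ℝ) : Fin 2 → ℂ :=
  ![Complex.cosh ((Real.sqrt (ρ / T) : ℂ) * waveLambda ρ T κ k * (ζ : ℂ)),
    ((Real.sqrt (ρ * T) : ℂ))⁻¹ *
      Complex.sinh ((Real.sqrt (ρ / T) : ℂ) * waveLambda ρ T κ k * (ζ : ℂ))]

/-- the matrix `M(ζ)` with rows `(cosh(√(ρ/T)λ₀ζ), −√(ρT)sinh(√(ρ/T)λ₀ζ))` and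
`(i·sinh(√(ρ/T)λ₀ζ), −i√(ρT)cosh(√(ρ/T)λ₀ζ))` -/
noncomputable def waveM (ρ T κ : ℝ) (ζ : ℝ) : Matrix (Fin 2) (Fin 2) ℂ :=
  Matrix.of
    ![![Complex.cosh ((Real.sqrt (ρ / T) : ℂ) * ((waveLambdaZero ρ T κ : ℝ) : ℂ) * (ζ : ℂ)),
        -(Real.sqrt (ρ * T) : ℂ) *
          Complex.sinh ((Real.sqrt (ρ / T) : ℂ) * ((waveLambdaZero ρ T κ : ℝ) : ℂ) * (ζ : ℂ))],
      ![Complex.I *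
          Complex.sinh ((Real.sqrt (ρ / T) : ℂ) * ((waveLambdaZero ρ T κ : ℝ) : ℂ) * (ζ : ℂ)),
        -Complex.I * (Real.sqrt (ρ * T) : ℂ) *
          Complex.cosh ((Real.sqrt (ρ / T) : ℂ) * ((waveLambdaZero ρ T κ : ℝ) : ℂ) * (ζ : ℂ))]]

/-- the multiplication operator `M` maps the eigenvector family `φ_k` to the
orthonormal family `(cos(kπζ), sin(kπζ))`: `M(ζ)·φ_k(ζ) = (cos(kπζ), sin(kπζ))`. -/
theorem wave_M_maps_eigenvectors_to_trigonometric
    (ρ T κ : ℝ) (hρ : 0 < ρ) (hT : 0 < T) (hκ : 0 < κ)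
    (hκ' : κ < Real.sqrt (ρ * T)) (k : ℤ) (ζ : ℝ) (hζ : ζ ∈ Set.Icc (0 : ℝ) 1) :
    waveM ρ T κ ζ *ᵥ wavePhi ρ T κ k ζ
      = ![Complex.cos ((k : ℂ) * (Real.pi : ℂ) * (ζ : ℂ)),
          Complex.sin ((k : ℂ) * (Real.pi : ℂ) * (ζ : ℂ))] := by
  have hR : (Real.sqrt (ρ * T) : ℂ) ≠ 0 :=
    Complex.ofReal_ne_zero.mpr (hκ.trans hκ').ne'
  have hs : (Real.sqrt (ρ / T) : ℂ) * (Real.sqrt (T / ρ) : ℂ) = 1 := by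
    rw [← Complex.ofReal_mul, ← Real.sqrt_mul (div_pos hρ hT).le,
      div_mul_div_cancel₀ hT.ne', div_self hρ.ne', Real.sqrt_one, Complex.ofReal_one]
  have harg : (Real.sqrt (ρ / T) : ℂ) * waveLambda ρ T κ k * (ζ : ℂ)
      = (Real.sqrt (ρ / T) : ℂ) * ((waveLambdaZero ρ T κ : ℝ) : ℂ) * (ζ : ℂ)
        + (k : ℂ) * (Real.pi : ℂ) * (ζ : ℂ) * Complex.I := by
    rw [waveLambda]
    linear_combination ((k : ℂ) * (Real.pi : ℂ) * (ζ : ℂ) * Complex.I) * hs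
  unfold waveM wavePhi
  rw [harg]
  generalize (Real.sqrt (ρ / T) : ℂ) * ((waveLambdaZero ρ T κ : ℝ) : ℂ) * (ζ : ℂ) = a
  generalize (k : ℂ) * (Real.pi : ℂ) * (ζ : ℂ) = b
  generalize (Real.sqrt (ρ * T) : ℂ) = r at hR ⊢
  have hcs := Complex.cosh_sq_sub_sinh_sq a
  rw [Complex.cosh_add, Complex.sinh_add, Complex.cosh_mul_I, Complex.sinh_mul_I]
  ext i
  fin_cases i
  · simp only [Matrix.mulVec, dotProduct, Fin.sum_univ_two, Matrix.of_apply, Fin.zero_eta,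
      Matrix.cons_val_zero, Matrix.cons_val_one]
    field_simp
    linear_combination Complex.cos b * hcs
  · simp only [Matrix.mulVec, dotProduct, Fin.sum_univ_two, Matrix.of_apply, Fin.mk_one,
      Matrix.cons_val_zero, Matrix.cons_val_one]
    field_simp
    linear_combination Complex.sin b * hcs
      + Complex.sin b * (Complex.sinh a ^ 2 - Complex.cosh a ^ 2) * Complex.I_sq
end

section
/- Let ρ, T, κ be real with ρ, T, κ > 0, let s > 0, set a := √(ρ/T) and Den(s) := √(ρT)·sinh(as) + κ·cosh(as) (which is positive). Define f₁, f₂ : [0,1] → ℝ by f₁(ζ) = −(ρ·cosh(a s(ζ−1)) − κ√(ρ/T)·sinh(a s(ζ−1)))/Den(s) and f₂(ζ) = −(√(ρ/T)·sinh(a s(ζ−1)) − (κ/T)·cosh(a s(ζ−1)))/Den(s). Then (f₁, f₂) solves the boundary value problem f₁′(ζ) = ρ s f₂(ζ) and T f₂′(ζ) = s f₁(ζ) on [0,1] with boundary conditions T f₂(1) + (κ/ρ) f₁(1) = 0 and T f₂(0) = 1. -/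
/-- the denominator `Den(s) = √(ρT)·sinh(√(ρ/T)s) + κ·cosh(√(ρ/T)s)` -/
noncomputable def waveDen (ρ T κ s : ℝ) : ℝ :=
  Real.sqrt (ρ * T) * Real.sinh (Real.sqrt (ρ / T) * s)
    + κ * Real.cosh (Real.sqrt (ρ / T) * s)

/-- `f₁(ζ) = −(ρ·cosh(as(ζ−1)) − κ√(ρ/T)·sinh(as(ζ−1)))/Den(s)`, with `a = √(ρ/T)` -/
noncomputable def waveF1 (ρ T κ s : ℝ) (ζ : ℝ) : ℝ :=
  -(ρ * Real.cosh (Real.sqrt (ρ / T) * s * (ζ - 1))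
      - κ * Real.sqrt (ρ / T) * Real.sinh (Real.sqrt (ρ / T) * s * (ζ - 1)))
    / waveDen ρ T κ s

/-- `f₂(ζ) = −(√(ρ/T)·sinh(as(ζ−1)) − (κ/T)·cosh(as(ζ−1)))/Den(s)`, with `a = √(ρ/T)` -/
noncomputable def waveF2 (ρ T κ s : ℝ) (ζ : ℝ) : ℝ :=
  -(Real.sqrt (ρ / T) * Real.sinh (Real.sqrt (ρ / T) * s * (ζ - 1))
      - (κ / T) * Real.cosh (Real.sqrt (ρ / T) * s * (ζ - 1)))
    / waveDen ρ T κ s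

/-- `(f₁, f₂)` solves the boundary value problem `f₁′ = ρsf₂`,
`Tf₂′ = sf₁` on `[0,1]` with `Tf₂(1) + (κ/ρ)f₁(1) = 0` and `Tf₂(0) = 1`
(and the denominator is positive). -/
theorem wave_control_operator_bvp
    (ρ T κ s : ℝ) (hρ : 0 < ρ) (hT : 0 < T) (hκ : 0 < κ) (hs : 0 < s) :
    0 < waveDen ρ T κ s
    ∧ (∀ ζ ∈ Set.Icc (0 : ℝ) 1,
        HasDerivAt (waveF1 ρ T κ s) (ρ * s * waveF2 ρ T κ s ζ) ζ
      ∧ HasDerivAt (fun z : ℝ => T * waveF2 ρ T κ s z) (s * waveF1 ρ T κ s ζ) ζ)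
    ∧ T * waveF2 ρ T κ s 1 + (κ / ρ) * waveF1 ρ T κ s 1 = 0
    ∧ T * waveF2 ρ T κ s 0 = 1 := by
  have ha : 0 < Real.sqrt (ρ / T) := Real.sqrt_pos.mpr (div_pos hρ hT)
  have hsq : T * Real.sqrt (ρ / T) ^ 2 = ρ := by
    rw [Real.sq_sqrt (div_pos hρ hT).le]
    field_simp
  have hrt : Real.sqrt (ρ * T) = T * Real.sqrt (ρ / T) := by
    rw [Real.sqrt_eq_iff_mul_self_eq (by positivity) (by positivity)]
    linear_combination -T * hsq
  have hD : 0 < waveDen ρ T κ s := by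
    have := Real.sinh_pos_iff.mpr (mul_pos ha hs)
    have := Real.cosh_pos (Real.sqrt (ρ / T) * s)
    unfold waveDen
    positivity
  refine ⟨hD, fun ζ _ => ?_, ?_, ?_⟩
  · have hlin : HasDerivAt (fun z : ℝ => Real.sqrt (ρ / T) * s * (z - 1))
        (Real.sqrt (ρ / T) * s * 1) ζ :=
      ((hasDerivAt_id ζ).sub_const 1).const_mul _
    have hc := hlin.cosh
    have hsh := hlin.sinh
    constructor
    · refine (((hc.const_mul ρ).sub
        (hsh.const_mul (κ * Real.sqrt (ρ / T)))).neg.div_const (waveDen ρ T κ s)).congr_deriv ?_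
      unfold waveF2
      generalize Real.sqrt (ρ / T) = a at *
      subst hsq
      field_simp
    · refine ((((hsh.const_mul (Real.sqrt (ρ / T))).sub
        (hc.const_mul (κ / T))).neg.div_const (waveDen ρ T κ s)).const_mul T).congr_deriv ?_
      unfold waveF1
      generalize Real.sqrt (ρ / T) = a at *
      subst hsq
      field_simp
  · simp only [waveF1, waveF2, sub_self, mul_zero, Real.cosh_zero, Real.sinh_zero]
    field_simp
    ring
  · have hne := hD.ne'
    unfold waveF2
    rw [← mul_div_assoc, div_eq_one_iff_eq hne]
    unfold waveDen
    rw [hrt, zero_sub, mul_neg_one, Real.sinh_neg, Real.cosh_neg]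
    field_simp
    ring
end

section
/- Let ρ, T, κ be real with ρ, T, κ > 0, let s > 0 and a := √(ρ/T). If (f₁, f₂) is any continuously differentiable pair on [0,1] satisfying f₁′(ζ) = ρ s f₂(ζ) and T f₂′(ζ) = s f₁(ζ) on [0,1] with T f₂(1) + (κ/ρ) f₁(1) = 0 and T f₂(0) = 1, then its output value is ρ^{−1} f₁(0) = −(1/√(ρT)) · (κ·sinh(as) + √(ρT)·cosh(as)) / (√(ρT)·sinh(as) + κ·cosh(as)); i.e., the transfer function of the damped wave system at s > 0 equals this expression. -/
/-- A solution of `u′ = cu` on `[0,1]` satisfies `u(1) = eᶜu(0)`. -/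
theorem eq_exp_mul_of_hasDerivAt {u : ℝ → ℝ} {c : ℝ}
    (h : ∀ x ∈ Set.Icc (0 : ℝ) 1, HasDerivAt u (c * u x) x) :
    u 1 = Real.exp c * u 0 := by
  have hd : ∀ x ∈ Set.Icc (0 : ℝ) 1,
      HasDerivAt (fun y => Real.exp (-(c * y)) * u y) 0 x := fun x hx => by
    have he : HasDerivAt (fun y => Real.exp (-(c * y))) (Real.exp (-(c * x)) * -(c * 1)) x :=
      ((hasDerivAt_id x).const_mul c).neg.exp
    exact (he.mul (h x hx)).congr_deriv (by ring)
  have hconst := constant_of_has_deriv_right_zero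
    (fun x hx => (hd x hx).continuousAt.continuousWithinAt)
    (fun x hx => (hd x (Set.Ico_subset_Icc_self hx)).hasDerivWithinAt) 1 (by simp)
  simp only [mul_one, mul_zero, neg_zero, Real.exp_zero, one_mul] at hconst
  rw [← hconst, ← mul_assoc, ← Real.exp_add, add_neg_cancel, Real.exp_zero, one_mul]

/-- any continuously differentiable pair `(f₁, f₂)` on `[0,1]` satisfying
`f₁′ = ρsf₂`, `Tf₂′ = sf₁` with `Tf₂(1) + (κ/ρ)f₁(1) = 0` and `Tf₂(0) = 1` has output
value `ρ⁻¹f₁(0) = −(1/√(ρT))·(κ·sinh(as) + √(ρT)·cosh(as))/(√(ρT)·sinh(as) + κ·cosh(as))`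
with `a = √(ρ/T)`; i.e., this is the transfer function of the damped wave system at `s`. -/
theorem wave_transfer_function
    (ρ T κ s : ℝ) (hρ : 0 < ρ) (hT : 0 < T) (hκ : 0 < κ) (hs : 0 < s)
    (f₁ f₂ : ℝ → ℝ)
    (hode : ∀ ζ ∈ Set.Icc (0 : ℝ) 1,
        HasDerivAt f₁ (ρ * s * f₂ ζ) ζ
      ∧ HasDerivAt (fun z : ℝ => T * f₂ z) (s * f₁ ζ) ζ)
    (hbc1 : T * f₂ 1 + (κ / ρ) * f₁ 1 = 0)
    (hbc0 : T * f₂ 0 = 1) :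
    ρ⁻¹ * f₁ 0
      = -(1 / Real.sqrt (ρ * T)) *
          ((κ * Real.sinh (Real.sqrt (ρ / T) * s)
              + Real.sqrt (ρ * T) * Real.cosh (Real.sqrt (ρ / T) * s))
            / (Real.sqrt (ρ * T) * Real.sinh (Real.sqrt (ρ / T) * s)
              + κ * Real.cosh (Real.sqrt (ρ / T) * s))) := by
  obtain ⟨a, ha, hρa⟩ : ∃ a : ℝ, 0 < a ∧ ρ = a ^ 2 * T :=
    ⟨√(ρ / T), by positivity, by rw [Real.sq_sqrt (by positivity)]; field_simp⟩
  subst hρa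
  have hsqrt_div : √(a ^ 2 * T / T) = a := by
    rw [mul_div_cancel_right₀ _ hT.ne', Real.sqrt_sq ha.le]
  have hsqrt_mul : √(a ^ 2 * T * T) = a * T := by
    rw [show a ^ 2 * T * T = (a * T) ^ 2 by ring, Real.sqrt_sq (by positivity)]
  rw [hsqrt_div, hsqrt_mul]
  have hplus := eq_exp_mul_of_hasDerivAt (u := fun z => a * (T * f₂ z) + f₁ z) (c := a * s)
    fun x hx => (((hode x hx).2.const_mul a).add (hode x hx).1).congr_deriv (by ring)
  have hminus := eq_exp_mul_of_hasDerivAt (u := fun z => a * (T * f₂ z) - f₁ z) (c := -(a * s))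
    fun x hx => (((hode x hx).2.const_mul a).sub (hode x hx).1).congr_deriv (by ring)
  simp only [hbc0, ← Real.cosh_add_sinh, Real.cosh_neg, Real.sinh_neg] at hplus hminus
  have hS : 0 < Real.sinh (a * s) := Real.sinh_pos_iff.mpr (by positivity)
  have hC : 0 < Real.cosh (a * s) := Real.cosh_pos _
  generalize Real.sinh (a * s) = S at *
  generalize Real.cosh (a * s) = C at *
  have hg : a * (T * f₂ 1) = a * C + S * f₁ 0 := by linarith
  have hf : f₁ 1 = a * S + C * f₁ 0 := by linarith
  have hden : a * T * S + κ * C ≠ 0 := by positivity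
  have hbc : a * T * (a * (T * f₂ 1)) + κ * f₁ 1 = 0 := by
    field_simp at hbc1
    linarith
  rw [hg, hf] at hbc
  field_simp
  linarith
end

section
/- Let A_d be a real n×n matrix, B_d a real n×m matrix, C_d a real p×n matrix, D_d a real p×m matrix, let Q be a symmetric positive semidefinite p×p matrix, R a symmetric positive definite m×m matrix, and Q̄ a symmetric positive semidefinite n×n matrix satisfying the discrete-time Lyapunov equation A_dᵀ Q̄ A_d − Q̄ = −C_dᵀ Q C_d. For a horizon N ≥ 1 define the Nm×Nm block matrix H with m×m blocks h_{i,j} (1 ≤ i,j ≤ N) given by h_{i,i} = D_dᵀQD_d + B_dᵀQ̄B_d + R, h_{i,j} = D_dᵀQC_dA_d^{i−j−1}B_d + B_dᵀQ̄A_d^{i−j}B_d for i > j, and h_{i,j} = h_{j,i}ᵀ for i < j. Then H is symmetric and positive definite. -/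
open Matrix

/-- the `m×m` block `h_{i,j}` of the MPC Hessian: `h_{i,i} = D_dᵀQD_d + B_dᵀQ̄B_d + R`,
`h_{i,j} = D_dᵀQC_dA_d^{i−j−1}B_d + B_dᵀQ̄A_d^{i−j}B_d` for `i > j`, and
`h_{i,j} = h_{j,i}ᵀ` for `i < j`. -/
noncomputable def mpcBlock {n m p N : ℕ}
    (Ad : Matrix (Fin n) (Fin n) ℝ) (Bd : Matrix (Fin n) (Fin m) ℝ)
    (Cd : Matrix (Fin p) (Fin n) ℝ) (Dd : Matrix (Fin p) (Fin m) ℝ)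
    (Q : Matrix (Fin p) (Fin p) ℝ) (R : Matrix (Fin m) (Fin m) ℝ)
    (Qbar : Matrix (Fin n) (Fin n) ℝ) (i j : Fin N) :
    Matrix (Fin m) (Fin m) ℝ :=
  if i = j then Ddᵀ * Q * Dd + Bdᵀ * Qbar * Bd + R
  else if (j : ℕ) < (i : ℕ) then
    Ddᵀ * Q * Cd * Ad ^ ((i : ℕ) - (j : ℕ) - 1) * Bd
      + Bdᵀ * Qbar * Ad ^ ((i : ℕ) - (j : ℕ)) * Bd
  else
    (Ddᵀ * Q * Cd * Ad ^ ((j : ℕ) - (i : ℕ) - 1) * Bd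
      + Bdᵀ * Qbar * Ad ^ ((j : ℕ) - (i : ℕ)) * Bd)ᵀ

/-- the `Nm×Nm` MPC Hessian `H` assembled from the blocks `h_{i,j}` -/
noncomputable def mpcHessian {n m p N : ℕ}
    (Ad : Matrix (Fin n) (Fin n) ℝ) (Bd : Matrix (Fin n) (Fin m) ℝ)
    (Cd : Matrix (Fin p) (Fin n) ℝ) (Dd : Matrix (Fin p) (Fin m) ℝ)
    (Q : Matrix (Fin p) (Fin p) ℝ) (R : Matrix (Fin m) (Fin m) ℝ)
    (Qbar : Matrix (Fin n) (Fin n) ℝ) :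
    Matrix (Fin N × Fin m) (Fin N × Fin m) ℝ :=
  fun x y => mpcBlock Ad Bd Cd Dd Q R Qbar x.1 y.1 x.2 y.2

/-- The state reached after `N` steps of `x ↦ A x + B u` from the origin. -/
def zeroInitialState {n m N : ℕ} (A : Matrix (Fin n) (Fin n) ℝ) (B : Matrix (Fin n) (Fin m) ℝ)
    (u : Fin N → Fin m → ℝ) : Fin n → ℝ :=
  ∑ j : Fin N, (A ^ (N - (j : ℕ) - 1) * B) *ᵥ u j

lemma zeroInitialState_succ {n m N : ℕ} (A : Matrix (Fin n) (Fin n) ℝ)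
    (B : Matrix (Fin n) (Fin m) ℝ) (u : Fin (N + 1) → Fin m → ℝ) :
    zeroInitialState A B u =
      A *ᵥ zeroInitialState A B (fun i : Fin N => u i.castSucc) + B *ᵥ u (Fin.last N) := by
  simp only [zeroInitialState, Fin.sum_univ_castSucc, mulVec_sum, mulVec_mulVec,
    ← Matrix.mul_assoc, ← pow_succ']
  congr 1
  · refine Finset.sum_congr rfl fun j _ => ?_
    rw [show N + 1 - (j.castSucc : ℕ) - 1 = N - (j : ℕ) - 1 + 1 by
      have := j.isLt; simp only [Fin.val_castSucc]; omega]
  · simp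

/-- The quadratic form of a matrix indexed by pairs, expanded in blocks. -/
lemma dotProduct_mulVec_prod {ι κ : Type*} [Fintype ι] [Fintype κ]
    (M : ι → ι → Matrix κ κ ℝ) (x : ι × κ → ℝ) :
    x ⬝ᵥ ((fun a b => M a.1 b.1 a.2 b.2 : Matrix (ι × κ) (ι × κ) ℝ) *ᵥ x) =
      ∑ i, ∑ j, (fun a => x (i, a)) ⬝ᵥ (M i j *ᵥ fun b => x (j, b)) := by
  simp only [dotProduct, mulVec, Fintype.sum_prod_type, Finset.mul_sum]
  exact Finset.sum_congr rfl fun i _ => Finset.sum_comm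

section

variable {n m p N : ℕ}
    (Ad : Matrix (Fin n) (Fin n) ℝ) (Bd : Matrix (Fin n) (Fin m) ℝ)
    (Cd : Matrix (Fin p) (Fin n) ℝ) (Dd : Matrix (Fin p) (Fin m) ℝ)
    {Q : Matrix (Fin p) (Fin p) ℝ} {R : Matrix (Fin m) (Fin m) ℝ}
    {Qbar : Matrix (Fin n) (Fin n) ℝ}

lemma mpcBlock_transpose (hQ : Qᵀ = Q) (hR : Rᵀ = R) (hQbar : Qbarᵀ = Qbar) (i j : Fin N) :
    (mpcBlock Ad Bd Cd Dd Q R Qbar i j)ᵀ = mpcBlock Ad Bd Cd Dd Q R Qbar j i := by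
  rcases lt_trichotomy i j with h | rfl | h
  · simp [mpcBlock, h.ne, h.ne', h.not_gt, h]
  · simp [mpcBlock, hQ, hR, hQbar, Matrix.mul_assoc]
  · simp [mpcBlock, h.ne, h.ne', h.not_gt, h]

lemma sum_mpcBlock_last (u : Fin (N + 1) → Fin m → ℝ) :
    ∑ j : Fin N, mpcBlock Ad Bd Cd Dd Q R Qbar (Fin.last N) j.castSucc *ᵥ u j.castSucc =
      (Ddᵀ * Q * Cd + Bdᵀ * Qbar * Ad) *ᵥ
        zeroInitialState Ad Bd (fun i : Fin N => u i.castSucc) := by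
  rw [zeroInitialState, mulVec_sum]
  refine Finset.sum_congr rfl fun j _ => ?_
  have h : N - (j : ℕ) = N - (j : ℕ) - 1 + 1 := by omega
  have hpow : Ad ^ (N - (j : ℕ)) = Ad * Ad ^ (N - (j : ℕ) - 1) := by
    rw [← pow_succ', ← h]
  simp [mpcBlock, (Fin.castSucc_lt_last j).ne', hpow, Matrix.mul_assoc, Matrix.add_mul]

/-- Completing squares along the trajectory: one step of the dynamics changes the storage
`⟨x, Q̄x⟩` plus the output cost by exactly the cross and diagonal terms of the Hessian. -/
lemma storage_step (hQ : Qᵀ = Q) (hQbar : Qbarᵀ = Qbar)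
    (hLyap : Adᵀ * Qbar * Ad - Qbar = -(Cdᵀ * Q * Cd)) (x : Fin n → ℝ) (v : Fin m → ℝ) :
    (Ad *ᵥ x + Bd *ᵥ v) ⬝ᵥ (Qbar *ᵥ (Ad *ᵥ x + Bd *ᵥ v)) +
        (Cd *ᵥ x + Dd *ᵥ v) ⬝ᵥ (Q *ᵥ (Cd *ᵥ x + Dd *ᵥ v)) =
      x ⬝ᵥ (Qbar *ᵥ x) + 2 * (v ⬝ᵥ ((Ddᵀ * Q * Cd + Bdᵀ * Qbar * Ad) *ᵥ x)) +
        v ⬝ᵥ ((Ddᵀ * Q * Dd + Bdᵀ * Qbar * Bd) *ᵥ v) := by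
  have hx : x ⬝ᵥ (Qbar *ᵥ x) =
      (Ad *ᵥ x) ⬝ᵥ (Qbar *ᵥ (Ad *ᵥ x)) + (Cd *ᵥ x) ⬝ᵥ (Q *ᵥ (Cd *ᵥ x)) := by
    have h : Qbar = Adᵀ * Qbar * Ad + Cdᵀ * Q * Cd := by
      rw [← neg_eq_iff_eq_neg.mpr hLyap]; abel
    conv_lhs => rw [h]
    simp [add_mulVec, dotProduct_add, ← mulVec_mulVec, dotProduct_mulVec _ _ᵀ, vecMul_transpose]
  have symm {k : ℕ} {S : Matrix (Fin k) (Fin k) ℝ} (hS : Sᵀ = S) (a b : Fin k → ℝ) :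
      a ⬝ᵥ (S *ᵥ b) = b ⬝ᵥ (S *ᵥ a) := by
    rw [dotProduct_mulVec, ← mulVec_transpose, hS, dotProduct_comm]
  rw [hx]
  simp only [add_mulVec, mulVec_add, dotProduct_add, add_dotProduct, ← mulVec_mulVec,
    dotProduct_mulVec _ _ᵀ, vecMul_transpose]
  rw [symm hQ (Cd *ᵥ x) (Dd *ᵥ v), symm hQbar (Ad *ᵥ x) (Bd *ᵥ v)]
  ring

/-- The Hessian form dominates the terminal storage plus the input cost. -/
lemma storage_add_input_cost_le (hQ : Q.PosSemidef) (hR : Rᵀ = R) (hQbar : Qbarᵀ = Qbar)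
    (hLyap : Adᵀ * Qbar * Ad - Qbar = -(Cdᵀ * Q * Cd)) (u : Fin N → Fin m → ℝ) :
    zeroInitialState Ad Bd u ⬝ᵥ (Qbar *ᵥ zeroInitialState Ad Bd u) + ∑ i, u i ⬝ᵥ (R *ᵥ u i) ≤
      ∑ i, ∑ j, u i ⬝ᵥ (mpcBlock Ad Bd Cd Dd Q R Qbar i j *ᵥ u j) := by
  have hQt : Qᵀ = Q := by simpa using hQ.isHermitian.eq
  induction N with
  | zero => simp [zeroInitialState]
  | succ N ih =>
    have ih := ih fun i => u i.castSucc
    have hblock (i j : Fin N) : mpcBlock Ad Bd Cd Dd Q R Qbar i.castSucc j.castSucc =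
        mpcBlock Ad Bd Cd Dd Q R Qbar i j := by
      simp [mpcBlock]
    have hcol (i : Fin N) :
        u i.castSucc ⬝ᵥ (mpcBlock Ad Bd Cd Dd Q R Qbar i.castSucc (Fin.last N) *ᵥ
          u (Fin.last N)) =
        u (Fin.last N) ⬝ᵥ (mpcBlock Ad Bd Cd Dd Q R Qbar (Fin.last N) i.castSucc *ᵥ
          u i.castSucc) := by
      rw [← mpcBlock_transpose Ad Bd Cd Dd hQt hR hQbar, dotProduct_mulVec, vecMul_transpose,
        dotProduct_comm]
    have hdiag : mpcBlock Ad Bd Cd Dd Q R Qbar (Fin.last N) (Fin.last N) =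
        Ddᵀ * Q * Dd + Bdᵀ * Qbar * Bd + R := by
      simp [mpcBlock]
    simp only [Fin.sum_univ_castSucc, Finset.sum_add_distrib, hblock, hcol]
    rw [← dotProduct_sum, sum_mpcBlock_last, hdiag, zeroInitialState_succ, add_mulVec _ R,
      dotProduct_add]
    set x := zeroInitialState Ad Bd fun i : Fin N => u i.castSucc
    have hstep := storage_step Ad Bd Cd Dd hQt hQbar hLyap x (u (Fin.last N))
    have hy := hQ.dotProduct_mulVec_nonneg (Cd *ᵥ x + Dd *ᵥ u (Fin.last N))
    rw [star_trivial] at hy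
    linarith

end

/-- if `Q` is symmetric positive semidefinite, `R` is symmetric positive
definite and `Q̄` is a symmetric positive semidefinite solution of the discrete-time
Lyapunov equation `A_dᵀQ̄A_d − Q̄ = −C_dᵀQC_d`, then for any horizon `N ≥ 1` the MPC
Hessian `H` is symmetric and positive definite. -/
theorem mpcHessian_isSymm_posDef {n m p N : ℕ} (hN : 1 ≤ N)
    (Ad : Matrix (Fin n) (Fin n) ℝ) (Bd : Matrix (Fin n) (Fin m) ℝ)
    (Cd : Matrix (Fin p) (Fin n) ℝ) (Dd : Matrix (Fin p) (Fin m) ℝ)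
    (Q : Matrix (Fin p) (Fin p) ℝ) (R : Matrix (Fin m) (Fin m) ℝ)
    (Qbar : Matrix (Fin n) (Fin n) ℝ)
    (hQ : Q.PosSemidef) (hR : R.PosDef) (hQbar : Qbar.PosSemidef)
    (hLyap : Adᵀ * Qbar * Ad - Qbar = -(Cdᵀ * Q * Cd)) :
    (mpcHessian (N := N) Ad Bd Cd Dd Q R Qbar).IsSymm
    ∧ (mpcHessian (N := N) Ad Bd Cd Dd Q R Qbar).PosDef := by
  have hQt : Qᵀ = Q := by simpa using hQ.isHermitian.eq
  have hRt : Rᵀ = R := by simpa using hR.isHermitian.eq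
  have hQbart : Qbarᵀ = Qbar := by simpa using hQbar.isHermitian.eq
  have hsymm : (mpcHessian (N := N) Ad Bd Cd Dd Q R Qbar).IsSymm := by
    ext a b
    exact congrFun (congrFun (mpcBlock_transpose Ad Bd Cd Dd hQt hRt hQbart b.1 a.1) a.2) b.2
  refine ⟨hsymm, PosDef.of_dotProduct_mulVec_pos (by simpa [IsHermitian] using hsymm.eq) ?_⟩
  intro x hx
  rw [star_trivial]
  unfold mpcHessian
  rw [dotProduct_mulVec_prod]
  set u : Fin N → Fin m → ℝ := fun i a => x (i, a)
  refine lt_of_lt_of_le ?_ (storage_add_input_cost_le Ad Bd Cd Dd hQ hRt hQbart hLyap u)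
  obtain ⟨⟨i, a⟩, hia⟩ := Function.ne_iff.mp hx
  have hV := hQbar.dotProduct_mulVec_nonneg (zeroInitialState Ad Bd u)
  rw [star_trivial] at hV
  refine add_pos_of_nonneg_of_pos hV (Finset.sum_pos' (fun i _ => ?_) ⟨i, Finset.mem_univ i, ?_⟩)
  · simpa using hR.posSemidef.dotProduct_mulVec_nonneg (u i)
  · have hu : u i ≠ 0 := fun h => hia (congrFun h a)
    simpa using hR.dotProduct_mulVec_pos hu
end
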